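/- Let p ≥ 1, let G be a finite simple graph with independence number α(G) = r, and let H be the complement of G. Then G is α-critical and belongs to W_p if and only if the following three conditions all hold: H is K_{r+1}-saturated; every maximal clique of H has size r; and every (r−1)-clique of H is contained in at least p copies of K_r, i.e., δ^cl_{r−1}(H) ≥ p. -/

import Mathlib

open Finset
open scoped Classical

/-- `S` is an independent set of the graph `G`. -/
def IsIndep {V : Type*} (G : SimpleGraph V) (S : Finset V) : Prop :=
  ∀ ⦃x⦄, x ∈ S → ∀ ⦃y⦄, y ∈ S → x ≠ y → ¬ G.Adj x y

/-- The independence number `α(G)` of a finite graph `G`. -/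
noncomputable def alpha {V : Type*} [Fintype V] (G : SimpleGraph V) : ℕ :=
  Finset.univ.sup fun S : Finset V => if IsIndep G S then S.card else 0

/-- `S` is a maximum independent set of `G`. -/
def IsMaxIndep {V : Type*} [Fintype V] (G : SimpleGraph V) (S : Finset V) : Prop :=
  IsIndep G S ∧ S.card = alpha G

/-- `S` is a maximal (inclusion-wise) independent set of `G`. -/
def IsMaximalIndep {V : Type*} [DecidableEq V] (G : SimpleGraph V) (S : Finset V) : Prop :=
  IsIndep G S ∧ ∀ x, x ∉ S → ¬ IsIndep G (insert x S)

/-- `G` is well-covered: every maximal independent set has cardinality `α(G)`. -/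
def WellCovered {V : Type*} [Fintype V] [DecidableEq V] (G : SimpleGraph V) : Prop :=
  ∀ S : Finset V, IsMaximalIndep G S → S.card = alpha G

/-- `G ∈ W_p`: `|V(G)| ≥ p` and every `p` pairwise disjoint independent sets extend to
`p` pairwise disjoint maximum independent sets. -/
def MemW {V : Type*} [Fintype V] (G : SimpleGraph V) (p : ℕ) : Prop :=
  p ≤ Fintype.card V ∧
    ∀ A : Fin p → Finset V, (∀ i, IsIndep G (A i)) →
      (∀ i j, i ≠ j → Disjoint (A i) (A j)) →
      ∃ M : Fin p → Finset V, (∀ i, IsMaxIndep G (M i)) ∧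
        (∀ i j, i ≠ j → Disjoint (M i) (M j)) ∧ ∀ i, A i ⊆ M i

/-- The `W`-index of `G`: the largest `p` with `G ∈ W_p`. -/
noncomputable def wIndex {V : Type*} [Fintype V] (G : SimpleGraph V) : ℕ :=
  sSup {p : ℕ | MemW G p}

/-- The fiber `F_G(S)`: the vertices `x ∉ S` with `S ∪ {x}` a maximum independent set. -/
noncomputable def fiber {V : Type*} [Fintype V] [DecidableEq V]
    (G : SimpleGraph V) (S : Finset V) : Finset V :=
  Finset.univ.filter fun x => x ∉ S ∧ IsMaxIndep G (insert x S)

/-- `G` is `α`-critical: deleting any edge increases the independence number. -/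
def AlphaCritical {V : Type*} [Fintype V] (G : SimpleGraph V) : Prop :=
  ∀ x y, G.Adj x y → alpha G < alpha (G.deleteEdges {s(x, y)})

/-- `H` is `K_t`-saturated: `H` is `K_t`-free but adding any missing edge creates a `K_t`. -/
def KSaturated {V : Type*} [Fintype V] (H : SimpleGraph V) (t : ℕ) : Prop :=
  (∀ Q : Finset V, ¬ H.IsNClique t Q) ∧
    ∀ x y : V, x ≠ y → ¬ H.Adj x y →
      ∃ Q : Finset V, (H ⊔ SimpleGraph.fromEdgeSet {s(x, y)}).IsNClique t Q

/-- `Q` is an inclusion-maximal clique of `H`. -/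
def IsMaximalClique {V : Type*} [DecidableEq V] (H : SimpleGraph V) (Q : Finset V) : Prop :=
  H.IsClique (Q : Set V) ∧ ∀ x, x ∉ Q → ¬ H.IsClique ((insert x Q : Finset V) : Set V)

/-- The `(r-1)`-clique-codegree of `Q` in `H`: the number of vertices extending `Q`
to an `r`-clique of `H`. -/
noncomputable def codeg {V : Type*} [Fintype V] [DecidableEq V]
    (H : SimpleGraph V) (r : ℕ) (Q : Finset V) : ℕ :=
  (Finset.univ.filter fun x => x ∉ Q ∧ H.IsNClique r (insert x Q)).card

/-- The minimum `(r-1)`-clique-codegree `δ^cl_{r-1}(H)`. -/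
noncomputable def minCliqueCodeg {V : Type*} [Fintype V] [DecidableEq V]
    (H : SimpleGraph V) (r : ℕ) : ℕ :=
  sInf {m : ℕ | ∃ Q : Finset V, H.IsNClique (r - 1) Q ∧ codeg H r Q = m}

/-- The vertex set of the localization `G_S = G - N_G[S]`. -/
noncomputable def localVerts {V : Type*} [Fintype V] (G : SimpleGraph V) (S : Finset V) :
    Finset V :=
  Finset.univ.filter fun v => v ∉ S ∧ ∀ s ∈ S, ¬ G.Adj s v

/-- The localization `G_S = G - N_G[S]`, as an induced subgraph. -/
noncomputable def localize {V : Type*} [Fintype V] (G : SimpleGraph V) (S : Finset V) :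
    SimpleGraph {v : V // v ∈ localVerts G S} :=
  SimpleGraph.comap (fun v => (v : V)) G

/-- The vertex set of the edge-localization `G_{ab} = G - (N_G(a) ∪ N_G(b))`. -/
noncomputable def edgeVerts {V : Type*} [Fintype V] (G : SimpleGraph V) (a b : V) : Finset V :=
  Finset.univ.filter fun v => ¬ G.Adj a v ∧ ¬ G.Adj b v

/-- The edge-localization `G_{ab} = G - (N_G(a) ∪ N_G(b))`, as an induced subgraph. -/
noncomputable def edgeLocalize {V : Type*} [Fintype V] (G : SimpleGraph V) (a b : V) :
    SimpleGraph {v : V // v ∈ edgeVerts G a b} :=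
  SimpleGraph.comap (fun v => (v : V)) G

section

variable {V : Type*} {G : SimpleGraph V}

theorem isIndep_iff_isClique_compl {S : Finset V} : IsIndep G S ↔ Gᶜ.IsClique (S : Set V) := by
  constructor
  · intro h x hx y hy hxy
    exact (SimpleGraph.compl_adj G x y).2 ⟨hxy, h hx hy hxy⟩
  · intro h x hx y hy hxy
    exact ((SimpleGraph.compl_adj G x y).1 (h hx hy hxy)).2

theorem IsIndep.mono {S T : Finset V} (hT : IsIndep G T) (hST : S ⊆ T) : IsIndep G S :=
  fun _ hx _ hy hxy => hT (hST hx) (hST hy) hxy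

theorem compl_deleteEdges_pair (x y : V) :
    (G.deleteEdges {s(x, y)})ᶜ = Gᶜ ⊔ SimpleGraph.fromEdgeSet {s(x, y)} := by
  ext a b
  simp only [SimpleGraph.compl_adj, SimpleGraph.deleteEdges_adj, SimpleGraph.sup_adj,
    SimpleGraph.fromEdgeSet_adj, Set.mem_singleton_iff]
  tauto

theorem isMaximalIndep_iff_isMaximalClique_compl [DecidableEq V] {S : Finset V} :
    IsMaximalIndep G S ↔ IsMaximalClique Gᶜ S := by
  simp only [IsMaximalIndep, IsMaximalClique, isIndep_iff_isClique_compl]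

variable [Fintype V]

theorem IsIndep.card_le_alpha {S : Finset V} (hS : IsIndep G S) : S.card ≤ alpha G := by
  have h := Finset.le_sup (f := fun S : Finset V => if IsIndep G S then S.card else 0)
    (Finset.mem_univ S)
  simp only [if_pos hS] at h
  exact h

theorem exists_isMaxIndep (G : SimpleGraph V) : ∃ S, IsMaxIndep G S := by
  obtain ⟨S, -, hS⟩ := Finset.exists_mem_eq_sup Finset.univ Finset.univ_nonempty
    (fun S : Finset V => if IsIndep G S then S.card else 0)
  change alpha G = _ at hS
  by_cases h : IsIndep G S
  · exact ⟨S, h, by simp [hS, h]⟩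
  · refine ⟨∅, by simp [IsIndep], ?_⟩
    simp [hS, h]

theorem alphaCritical_iff_kSaturated_compl :
    AlphaCritical G ↔ KSaturated Gᶜ (alpha G + 1) := by
  constructor
  · intro h
    refine ⟨fun Q hQ => ?_, fun x y hxy hadj => ?_⟩
    · have := (isIndep_iff_isClique_compl.2 hQ.isClique).card_le_alpha
      have := hQ.card_eq
      omega
    · have hG : G.Adj x y := by simpa [SimpleGraph.compl_adj, hxy] using hadj
      obtain ⟨S, hS, hcard⟩ := exists_isMaxIndep (G.deleteEdges {s(x, y)})
      obtain ⟨Q, hQS, hQ⟩ := Finset.exists_subset_card_eq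
        (show alpha G + 1 ≤ S.card from hcard ▸ h x y hG)
      refine ⟨Q, ?_, hQ⟩
      rw [← compl_deleteEdges_pair]
      exact isIndep_iff_isClique_compl.1 (hS.mono hQS)
  · rintro ⟨-, h⟩ x y hG
    obtain ⟨Q, hQ⟩ := h x y hG.ne (by simp [SimpleGraph.compl_adj, hG])
    rw [← compl_deleteEdges_pair] at hQ
    have := (isIndep_iff_isClique_compl.2 hQ.isClique).card_le_alpha
    have := hQ.card_eq
    omega

variable [DecidableEq V]

theorem codeg_compl_eq_card_fiber (S : Finset V) :
    codeg Gᶜ (alpha G) S = (fiber G S).card := by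
  simp only [codeg, fiber, IsMaxIndep, isIndep_iff_isClique_compl,
    SimpleGraph.isNClique_iff]

theorem mem_fiber {S : Finset V} {x : V} :
    x ∈ fiber G S ↔ x ∉ S ∧ IsMaxIndep G (insert x S) := by
  simp [fiber]

theorem MemW.wellCovered {p : ℕ} (hp : 1 ≤ p) (h : MemW G p) : WellCovered G := by
  intro S hS
  obtain ⟨M, hM, -, hsub⟩ := h.2 (fun i => if i.val = 0 then S else ∅)
    (fun i => by
      split_ifs
      · exact hS.1
      · simp [IsIndep])
    (fun i j hij => by
      split_ifs
      · exact absurd (Fin.ext (by omega)) hij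
      all_goals simp)
  have hSM : S ⊆ M ⟨0, hp⟩ := by simpa using hsub ⟨0, hp⟩
  have hMS : M ⟨0, hp⟩ ⊆ S := by
    intro x hx
    by_contra hxS
    exact hS.2 x hxS ((hM ⟨0, hp⟩).1.mono (Finset.insert_subset hx hSM))
  rw [hSM.antisymm hMS]
  exact (hM _).2

theorem MemW.le_card_fiber {p : ℕ} (hp : 1 ≤ p) (h : MemW G p) {S : Finset V}
    (hS : IsIndep G S) (hcard : S.card + 1 = alpha G) : p ≤ (fiber G S).card := by
  by_contra! hlt
  let e := (fiber G S).equivFin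
  let B : Fin p → Finset V := fun i =>
    Finset.univ.filter fun x => ∃ hx : x ∈ fiber G S, (e ⟨x, hx⟩).val + 1 = i.val
  have hB : ∀ i x, x ∈ B i ↔ ∃ hx : x ∈ fiber G S, (e ⟨x, hx⟩).val + 1 = i.val := by
    simp [B]
  have hSB : ∀ i, Disjoint S (B i) := fun i => by
    rw [Finset.disjoint_left]
    intro x hx hxB
    obtain ⟨hf, -⟩ := (hB i x).1 hxB
    exact (mem_fiber.1 hf).1 hx
  obtain ⟨M, hM, hdisj, hsub⟩ := h.2 (fun i => if i.val = 0 then S else B i)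
    (fun i => by
      split_ifs
      · exact hS
      · intro x hx y hy hxy
        obtain ⟨hx, hxi⟩ := (hB i x).1 hx
        obtain ⟨hy, hyi⟩ := (hB i y).1 hy
        have : e ⟨x, hx⟩ = e ⟨y, hy⟩ := Fin.ext (by omega)
        exact absurd (congrArg Subtype.val (e.injective this)) hxy)
    (fun i j hij => by
      split_ifs
      · exact absurd (Fin.ext (by omega)) hij
      · exact hSB j
      · exact (hSB i).symm
      · rw [Finset.disjoint_left]
        intro x hxi hxj
        obtain ⟨hx, hxi⟩ := (hB i x).1 hxi
        obtain ⟨_, hxj⟩ := (hB j x).1 hxj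
        exact hij (Fin.ext (by omega)))
  have hSM : S ⊆ M ⟨0, hp⟩ := by simpa using hsub ⟨0, hp⟩
  obtain ⟨x, hxM, hxS⟩ := Finset.exists_mem_notMem_of_card_lt_card
    (show S.card < (M ⟨0, hp⟩).card by rw [(hM _).2]; omega)
  have hxF : x ∈ fiber G S := mem_fiber.2
    ⟨hxS, (hM ⟨0, hp⟩).1.mono (Finset.insert_subset hxM hSM),
      by rw [Finset.card_insert_of_notMem hxS, hcard]⟩
  let j : Fin p := ⟨(e ⟨x, hxF⟩).val + 1, by have := (e ⟨x, hxF⟩).isLt; omega⟩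
  have hxj : x ∈ M j := by
    apply hsub j
    simpa [j] using (hB j x).2 ⟨hxF, rfl⟩
  exact Finset.disjoint_left.1 (hdisj ⟨0, hp⟩ j (by simp [j, Fin.ext_iff])) hxM hxj

theorem WellCovered.exists_isMaxIndep_superset (h : WellCovered G) {S : Finset V}
    (hS : IsIndep G S) : ∃ T, S ⊆ T ∧ IsMaxIndep G T := by
  obtain ⟨T, hT, hmax⟩ := Finset.exists_max_image
    (Finset.univ.filter fun T : Finset V => S ⊆ T ∧ IsIndep G T) Finset.card
    ⟨S, by simp [hS]⟩
  simp only [Finset.mem_filter, Finset.mem_univ, true_and] at hT hmax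
  refine ⟨T, hT.1, hT.2, h T ⟨hT.2, fun x hx hins => ?_⟩⟩
  have := hmax _ ⟨hT.1.trans (Finset.subset_insert x T), hins⟩
  rw [Finset.card_insert_of_notMem hx] at this
  omega

theorem isClique_fiber {S : Finset V} (hcard : S.card + 1 = alpha G) :
    G.IsClique (fiber G S : Set V) := by
  intro x hx y hy hxy
  obtain ⟨hxS, hx, -⟩ := mem_fiber.1 hx
  obtain ⟨hyS, hy, -⟩ := mem_fiber.1 hy
  by_contra hadj
  have hind : IsIndep G (insert x (insert y S)) := by
    intro a ha b hb hab
    rcases Finset.mem_insert.1 ha with rfl | ha' <;> rcases Finset.mem_insert.1 hb with rfl | hb'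
    · exact absurd rfl hab
    · rcases Finset.mem_insert.1 hb' with rfl | hb'
      · exact hadj
      · exact hx (Finset.mem_insert_self _ _) (Finset.mem_insert_of_mem hb') hab
    · rcases Finset.mem_insert.1 ha' with rfl | ha'
      · exact fun h => hadj h.symm
      · exact hx (Finset.mem_insert_of_mem ha') (Finset.mem_insert_self _ _) hab
    · exact hy ha' hb' hab
  have := hind.card_le_alpha
  rw [Finset.card_insert_of_notMem (by simp [hxy, hxS]), Finset.card_insert_of_notMem hyS] at this
  omega

/-- If `G` is well-covered and has large fibers, a non-maximum independent set grows by a vertex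
avoiding any fewer than `p` further independent sets. -/
theorem WellCovered.exists_insert_avoiding (h : WellCovered G) {p : ℕ}
    (hf : ∀ S, IsIndep G S → S.card + 1 = alpha G → p ≤ (fiber G S).card)
    (B : Fin p → Finset V) (hB : ∀ i, IsIndep G (B i)) (i : Fin p)
    (hcard : (B i).card < alpha G) :
    ∃ x, x ∉ B i ∧ IsIndep G (insert x (B i)) ∧ ∀ j, j ≠ i → x ∉ B j := by
  obtain ⟨T, hBT, hT⟩ := h.exists_isMaxIndep_superset (hB i)
  obtain ⟨Q, hBQ, hQT, hQ⟩ := Finset.exists_subsuperset_card_eq hBT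
    (show (B i).card ≤ alpha G - 1 by omega) (by rw [hT.2]; omega)
  have hQ' : Q.card + 1 = alpha G := by omega
  have hle := hf Q (hT.1.mono hQT) hQ'
  suffices ∃ x ∈ fiber G Q, ∀ j, j ≠ i → x ∉ B j by
    obtain ⟨x, hx, hxj⟩ := this
    obtain ⟨hxQ, hx, -⟩ := mem_fiber.1 hx
    exact ⟨x, fun hxB => hxQ (hBQ hxB), hx.mono (Finset.insert_subset_insert x hBQ), hxj⟩
  by_contra! hcov
  have : Nonempty (Fin p) := ⟨i⟩
  choose! f hfi hfB using hcov
  have hinj : Set.InjOn f (fiber G Q : Set V) := by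
    intro x hx y hy hxy
    by_contra hne
    exact hB (f x) (hfB x hx) (hxy ▸ hfB y hy) hne (isClique_fiber hQ' hx hy hne)
  have := Finset.card_le_card_of_injOn f (t := Finset.univ.erase i)
    (fun x hx => by simpa using hfi x hx) hinj
  rw [Finset.card_erase_of_mem (Finset.mem_univ i), Finset.card_univ, Fintype.card_fin] at this
  have := i.isLt
  omega

theorem WellCovered.memW (h : WellCovered G) {p : ℕ} (hcard : p ≤ Fintype.card V)
    (hf : ∀ S, IsIndep G S → S.card + 1 = alpha G → p ≤ (fiber G S).card) : MemW G p := by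
  refine ⟨hcard, fun A hA hAdisj => ?_⟩
  obtain ⟨M, hM, hmax⟩ := Finset.exists_max_image
    (Finset.univ.filter fun B : Fin p → Finset V => (∀ i, IsIndep G (B i)) ∧
      (∀ i j, i ≠ j → Disjoint (B i) (B j)) ∧ ∀ i, A i ⊆ B i)
    (fun B => ∑ i, (B i).card) ⟨A, by simpa using ⟨hA, hAdisj⟩⟩
  simp only [Finset.mem_filter, Finset.mem_univ, true_and] at hM hmax
  obtain ⟨hind, hdisj, hsub⟩ := hM
  refine ⟨M, fun i => ⟨hind i, ?_⟩, hdisj, hsub⟩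
  by_contra hne
  obtain ⟨x, hxi, hxind, hxj⟩ := h.exists_insert_avoiding hf M hind i
    (lt_of_le_of_ne (hind i).card_le_alpha hne)
  have hle := hmax (Function.update M i (insert x (M i))) ⟨fun j => ?_, fun j k hjk => ?_,
    fun j => ?_⟩
  · refine absurd hle (not_le.2 (Finset.sum_lt_sum (fun j _ => ?_) ⟨i, Finset.mem_univ i, ?_⟩))
    · rcases eq_or_ne j i with rfl | hj
      · simp [Finset.card_le_card]
      · simp [hj]
    · simp [Finset.card_insert_of_notMem hxi]
  · rcases eq_or_ne j i with rfl | hj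
    · simpa using hxind
    · simpa [hj] using hind j
  · rcases eq_or_ne j i with rfl | hj
    · simpa [hjk.symm] using ⟨hxj k hjk.symm, hdisj j k hjk⟩
    · rcases eq_or_ne k i with rfl | hk
      · simpa [hj] using ⟨hxj j hj, hdisj j k hjk⟩
      · simpa [hj, hk] using hdisj j k hjk
  · rcases eq_or_ne j i with rfl | hj
    · simpa using (hsub j).trans (Finset.subset_insert x (M j))
    · simpa [hj] using hsub j

end

/-- Main characterization, complement/saturation form. -/
theorem alphaCritical_and_wp_iff_complement {V : Type*} [Fintype V] [DecidableEq V]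
    (G : SimpleGraph V) (p r : ℕ) (hp : 1 ≤ p) (halpha : alpha G = r) :
    (AlphaCritical G ∧ MemW G p) ↔
      (KSaturated Gᶜ (r + 1) ∧
        (∀ Q : Finset V, IsMaximalClique Gᶜ Q → Q.card = r) ∧
        ∀ Q : Finset V, Gᶜ.IsNClique (r - 1) Q → p ≤ codeg Gᶜ r Q) := by
  subst halpha
  rw [alphaCritical_iff_kSaturated_compl]
  refine and_congr_right fun _ => ?_
  simp only [← isMaximalIndep_iff_isMaximalClique_compl, codeg_compl_eq_card_fiber,
    SimpleGraph.isNClique_iff, ← isIndep_iff_isClique_compl]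
  constructor
  · intro h
    refine ⟨h.wellCovered hp, fun Q hQ => h.le_card_fiber hp hQ.1 ?_⟩
    obtain ⟨v⟩ : Nonempty V := Fintype.card_pos_iff.1 (hp.trans h.1)
    have hv : IsIndep G {v} := fun x hx y hy hxy => by simp_all
    have := hv.card_le_alpha
    rw [Finset.card_singleton] at this
    omega
  · rintro ⟨hwc, hf⟩
    obtain ⟨T, hT⟩ := exists_isMaxIndep G
    obtain ⟨Q, hQT, hQ⟩ := Finset.exists_subset_card_eq
      (show alpha G - 1 ≤ T.card by rw [hT.2]; omega)
    exact WellCovered.memW hwc ((hf Q ⟨hT.1.mono hQT, hQ⟩).trans (Finset.card_le_univ _))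
      fun S hS hcard => hf S ⟨hS, by omega⟩
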